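/- The number of pipes produced by the MPCA greedy algorithm on job sequence S equals the maximum number of pipes over all full magazine state sequences: MPCA(T_1,...,T_n; C; S) = max_{M ∈ M(S)} |T(M)|. Consequently, min_{M ∈ M(S)} switches(M) = Σ_{i=1}^n |T_i| − C − MPCA(S). -/

import Mathlib

/-- A pipe `π_{s,e}^t` of the magazine state sequence `M`. -/
def IsPipe (n : ℕ) (T M : ℕ → Finset ℕ) (s e t : ℕ) : Prop :=
  1 ≤ s ∧ s < e ∧ e ≤ n ∧ t ∈ T s ∧ t ∈ T e ∧
    ∀ i, s < i → i < e → t ∉ T i ∧ t ∈ M i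

/-- `T(M)`: the set of pipes of `M`. -/
def pipeSet (n : ℕ) (T M : ℕ → Finset ℕ) : Set (ℕ × ℕ × ℕ) :=
  {p | IsPipe n T M p.1 p.2.1 p.2.2}

/-- `M(S)`: full magazine state sequences for the job order `1, …, n`. -/
def MS (n C : ℕ) (T : ℕ → Finset ℕ) : Set (ℕ → Finset ℕ) :=
  {M | ∀ i ∈ Finset.Icc 1 n, T i ⊆ M i ∧ (M i).card = C}

/-- Total number of tool switches of a magazine state sequence. -/
def switches (n C : ℕ) (M : ℕ → Finset ℕ) : ℕ :=
  ∑ i ∈ Finset.Icc 1 (n - 1), (C - ((M i) ∩ (M (i + 1))).card)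

/-- Pick (arbitrary) `k` elements of a finite set of tools. -/
def takeSome (s : Finset ℕ) (k : ℕ) : Finset ℕ :=
  ((s.sort (· ≤ ·)).take k).toFinset

/-- Inner loop of MPCA: for a fixed `end = e`, iterate `start = e-1, …, 1`
(the first argument is the current `start`); for each `start` compute the
candidate tools `(T start ∩ T e) \ ⋃_{start<i<e} T i`, construct as many of
the candidate pipes as the minimal number of empty slots at the intermediate
instants allows (adding their tools to `M (start+1), …, M (e-1)`), and return
the updated states together with the number of pipes constructed. -/
def mpcaInner (C : ℕ) (T : ℕ → Finset ℕ) (e : ℕ) :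
    ℕ → (ℕ → Finset ℕ) → ((ℕ → Finset ℕ) × ℕ)
  | 0, M => (M, 0)
  | k + 1, M =>
    let s := k + 1
    let candidates := (T s ∩ T e).filter fun t => ∀ i ∈ Finset.Ioo s e, t ∉ T i
    let emptySlots :=
      if h : (Finset.Ioo s e).Nonempty then
        (Finset.Ioo s e).inf' h (fun i => C - (M i).card)
      else candidates.card
    let chosen := takeSome candidates (min candidates.card emptySlots)
    let M' := fun i => if i ∈ Finset.Ioo s e then M i ∪ chosen else M i
    let r := mpcaInner C T e k M'
    (r.1, r.2 + chosen.card)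

/-- Outer loop of MPCA: iterate `end = 2, …, n` (first argument is the current
upper bound of `end`), accumulating constructed pipes. -/
def mpcaOuter (C : ℕ) (T : ℕ → Finset ℕ) : ℕ → (ℕ → Finset ℕ) → ((ℕ → Finset ℕ) × ℕ)
  | 0, M => (M, 0)
  | e + 1, M =>
    let r := mpcaOuter C T e M
    let r2 := mpcaInner C T (e + 1) e r.1
    (r2.1, r.2 + r2.2)

/-- The Max Pipe Construction Algorithm: starting from `M i := T i`, greedily
construct pipes and return the number of pipes constructed. -/
def MPCA (n C : ℕ) (T : ℕ → Finset ℕ) : ℕ := (mpcaOuter C T n T).2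

/-- A potential pipe. -/
def Pot (n : ℕ) (T : ℕ → Finset ℕ) (p : ℕ × ℕ × ℕ) : Prop :=
  1 ≤ p.1 ∧ p.1 < p.2.1 ∧ p.2.1 ≤ n ∧ p.2.2 ∈ T p.1 ∧ p.2.2 ∈ T p.2.1 ∧
    ∀ i, p.1 < i → i < p.2.1 → p.2.2 ∉ T i

/-- Number of pipes of `Y` that pass through instant `i`. -/
def ld (Y : Finset (ℕ × ℕ × ℕ)) (i : ℕ) : ℕ := (Y.filter (fun p => p.1 < i ∧ i < p.2.1)).card

lemma ld_mono {Y Z : Finset (ℕ × ℕ × ℕ)} (h : Y ⊆ Z) (i : ℕ) : ld Y i ≤ ld Z i :=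
  Finset.card_le_card (Finset.filter_subset_filter _ h)

lemma ld_insert {Y : Finset (ℕ × ℕ × ℕ)} {p : ℕ × ℕ × ℕ} (h : p ∉ Y) (i : ℕ) :
    ld (insert p Y) i = ld Y i + if p.1 < i ∧ i < p.2.1 then 1 else 0 := by
  unfold ld
  rw [Finset.filter_insert]
  split_ifs with hc
  · rw [Finset.card_insert_of_notMem]
    simp [h]
  · simp

lemma Pot.unique {n : ℕ} {T : ℕ → Finset ℕ} {p q : ℕ × ℕ × ℕ} (hp : Pot n T p) (hq : Pot n T q)
    (ht : p.2.2 = q.2.2) {i : ℕ} (h1 : p.1 < i) (h2 : i < p.2.1) (h3 : q.1 < i) (h4 : i < q.2.1) :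
    p = q := by
  obtain ⟨s, e, t⟩ := p
  obtain ⟨s', e', t'⟩ := q
  obtain ⟨a1, a2, a3, a4, a5, a6⟩ := hp
  obtain ⟨b1, b2, b3, b4, b5, b6⟩ := hq
  simp only at *
  subst ht
  have e1 : s = s' := by
    rcases lt_trichotomy s s' with h | h | h
    · exact absurd b4 (a6 s' h (by omega))
    · exact h
    · exact absurd a4 (b6 s h (by omega))
  have e2 : e = e' := by
    rcases lt_trichotomy e e' with h | h | h
    · exact absurd a5 (b6 e (by omega) h)
    · exact h
    · exact absurd b5 (a6 e' (by omega) h)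
  rw [e1, e2]

lemma Pot.unique_end {n : ℕ} {T : ℕ → Finset ℕ} {p q : ℕ × ℕ × ℕ} (hp : Pot n T p)
    (hq : Pot n T q) (ht : p.2.2 = q.2.2) (h : p.2.1 = q.2.1) : p = q := by
  obtain ⟨s, e, t⟩ := p
  obtain ⟨s', e', t'⟩ := q
  obtain ⟨a1, a2, a3, a4, a5, a6⟩ := hp
  obtain ⟨b1, b2, b3, b4, b5, b6⟩ := hq
  simp only at *
  subst ht
  subst h
  have e1 : s = s' := by
    rcases lt_trichotomy s s' with h | h | h
    · exact absurd b4 (a6 s' h (by omega))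
    · exact h
    · exact absurd a4 (b6 s h (by omega))
  rw [e1]

/-- Optimality of the greedy choice, abstract form. -/
lemma greedy_opt (c : ℕ → ℕ) (G : Finset (ℕ × ℕ × ℕ)) (hG : ∀ i, ld G i ≤ c i) :
    ∀ (N : ℕ) (X : Finset (ℕ × ℕ × ℕ)), (G \ X).card = N → (∀ i, ld X i ≤ c i) →
    (∀ p ∈ X, p ∉ G → ∃ i, p.1 < i ∧ i < p.2.1 ∧
      c i ≤ ld (G.filter (fun q => q.2.1 ≤ p.2.1)) i) → X.card ≤ G.card := by
  intro N
  induction N using Nat.strong_induction_on with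
  | _ N ih =>
  intro X hN hX hrej
  have key : ∀ p ∈ X, p ∉ G → ¬ (G.filter (fun q => q.2.1 ≤ p.2.1) ⊆ X) := by
    intro p hpX hpG hsub
    obtain ⟨i, h1, h2, h3⟩ := hrej p hpX hpG
    have h4 : insert p (G.filter (fun q => q.2.1 ≤ p.2.1)) ⊆ X :=
      Finset.insert_subset hpX hsub
    have h5 := ld_mono h4 i
    rw [ld_insert (by simp [hpG]), if_pos ⟨h1, h2⟩] at h5
    have := hX i
    omega
  by_cases hne : (G \ X).Nonempty
  · obtain ⟨p, hp, hmin⟩ := Finset.exists_min_image (G \ X) (fun q => q.2.1) hne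
    rw [Finset.mem_sdiff] at hp
    obtain ⟨hpG, hpX⟩ := hp
    have hlate : ∀ q ∈ X, q ∉ G → p.2.1 ≤ q.2.1 := by
      intro q hqX hqG
      by_contra hlt
      apply key q hqX hqG
      intro g hg
      rw [Finset.mem_filter] at hg
      by_contra hgX
      have := hmin g (Finset.mem_sdiff.2 ⟨hg.1, hgX⟩)
      omega
    by_cases hfeas : ∀ i, ld (insert p X) i ≤ c i
    · have hlt : (G \ insert p X).card < N := by
        rw [← hN]
        apply Finset.card_lt_card
        refine ⟨Finset.sdiff_subset_sdiff le_rfl (Finset.subset_insert _ _), fun h => ?_⟩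
        have := h (Finset.mem_sdiff.2 ⟨hpG, hpX⟩)
        simp at this
      have := ih _ hlt (insert p X) rfl hfeas (by
        intro q hq hqG
        rcases Finset.mem_insert.1 hq with rfl | hq
        · exact absurd hpG hqG
        · exact hrej q hq hqG)
      rw [Finset.card_insert_of_notMem hpX] at this
      omega
    · push Not at hfeas
      classical
      have hi0 := Nat.find_spec hfeas
      have hi0min : ∀ i, i < Nat.find hfeas → ld (insert p X) i ≤ c i := fun i hi =>
        not_lt.1 (Nat.find_min hfeas hi)
      generalize Nat.find hfeas = i0 at hi0 hi0min
      have hcov : p.1 < i0 ∧ i0 < p.2.1 := by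
        by_contra hc
        rw [ld_insert hpX, if_neg hc] at hi0
        have := hX i0
        omega
      have hJ : ∃ J ∈ insert p X, J ∉ G ∧ J.1 < i0 ∧ i0 < J.2.1 := by
        by_contra hno
        push Not at hno
        have : ld (insert p X) i0 ≤ ld G i0 := by
          apply Finset.card_le_card
          intro q hq
          rw [Finset.mem_filter] at hq ⊢
          refine ⟨?_, hq.2⟩
          by_contra hqG
          have := hno q hq.1 hqG hq.2.1
          omega
        have := hG i0
        omega
      obtain ⟨J, hJ1, hJG, hJ2, hJ3⟩ := hJ
      have hJX : J ∈ X := by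
        rcases Finset.mem_insert.1 hJ1 with rfl | h
        · exact absurd hpG hJG
        · exact h
      have hJe := hlate J hJX hJG
      have hpE : p ∉ X.erase J := fun h => hpX (Finset.mem_of_mem_erase h)
      have hXJ : ∀ i, ld X i = ld (X.erase J) i + if J.1 < i ∧ i < J.2.1 then 1 else 0 := by
        intro i
        rw [← ld_insert (Finset.notMem_erase _ _), Finset.insert_erase hJX]
      have hlt : (G \ insert p (X.erase J)).card < N := by
        rw [← hN]
        apply Finset.card_lt_card
        refine ⟨?_, fun h => ?_⟩
        · intro q hq
          simp only [Finset.mem_sdiff, Finset.mem_insert, Finset.mem_erase, not_or, not_and] at hq ⊢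
          refine ⟨hq.1, fun hqX => hq.2.2 ?_ hqX⟩
          rintro rfl
          exact hJG hq.1
        · have := h (Finset.mem_sdiff.2 ⟨hpG, hpX⟩)
          simp at this
      have := ih _ hlt (insert p (X.erase J)) rfl (by
        intro i
        have a1 := hX i
        have a2 := hXJ i
        have a3 := hi0min i
        rw [ld_insert hpX] at a3
        rw [ld_insert hpE]
        split_ifs at * <;> omega) (by
        intro q hq hqG
        rcases Finset.mem_insert.1 hq with rfl | hq
        · exact absurd hpG hqG
        · exact hrej q (Finset.mem_of_mem_erase hq) hqG)
      rw [Finset.card_insert_of_notMem hpE, Finset.card_erase_of_mem hJX] at this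
      have := Finset.card_pos.2 ⟨J, hJX⟩
      omega
  · rw [Finset.not_nonempty_iff_eq_empty, Finset.sdiff_eq_empty_iff_subset] at hne
    apply Finset.card_le_card
    intro p hp
    by_contra hpG
    exact key p hp hpG ((Finset.filter_subset _ _).trans hne)

lemma takeSome_subset (s : Finset ℕ) (k : ℕ) : takeSome s k ⊆ s := by
  intro x hx
  unfold takeSome at hx
  rw [List.mem_toFinset] at hx
  exact (Finset.mem_sort (· ≤ ·)).1 (List.mem_of_mem_take hx)

lemma takeSome_card (s : Finset ℕ) (k : ℕ) : (takeSome s k).card = min k s.card := by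
  unfold takeSome
  rw [List.toFinset_card_of_nodup]
  · simp
  · exact (Finset.sort_nodup s (· ≤ ·)).sublist (List.take_sublist _ _)

/-- Loop invariant: `G` is the set of pipes constructed so far. -/
structure PInv (n C : ℕ) (T : ℕ → Finset ℕ) (e k : ℕ) (G : Finset (ℕ × ℕ × ℕ))
    (M : ℕ → Finset ℕ) : Prop where
  sub : ∀ p ∈ G, Pot n T p ∧ (p.2.1 < e ∨ (p.2.1 = e ∧ k < p.1))
  mem : ∀ i t, t ∈ M i ↔ t ∈ T i ∨ ∃ p ∈ G, p.2.2 = t ∧ p.1 < i ∧ i < p.2.1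
  cap : ∀ i ∈ Finset.Icc 1 n, (M i).card ≤ C
  card : ∀ i, (M i).card = (T i).card + ld G i
  rej : ∀ p, Pot n T p → (p.2.1 < e ∨ (p.2.1 = e ∧ k < p.1)) → p ∉ G →
    ∃ i, p.1 < i ∧ i < p.2.1 ∧ C ≤ (T i).card + ld (G.filter (fun q => q.2.1 ≤ p.2.1)) i

lemma inv_step {n C : ℕ} {T : ℕ → Finset ℕ} {e k : ℕ} {G : Finset (ℕ × ℕ × ℕ)}
    {M : ℕ → Finset ℕ} (hen : e ≤ n) (hke : k + 1 < e) (h : PInv n C T e (k + 1) G M)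
    (Q : Finset ℕ)
    (hQ : ∀ t ∈ Q, Pot n T (k + 1, e, t))
    (hroom : ∀ i ∈ Finset.Ioo (k + 1) e, (M i).card + Q.card ≤ C)
    (hfull : (∀ t, Pot n T (k + 1, e, t) → t ∈ Q) ∨
      ∃ i ∈ Finset.Ioo (k + 1) e, C ≤ (M i).card + Q.card) :
    PInv n C T e k (G ∪ Q.image (fun t => (k + 1, e, t)))
      (fun i => if i ∈ Finset.Ioo (k + 1) e then M i ∪ Q else M i) ∧
    (G ∪ Q.image (fun t => (k + 1, e, t))).card = G.card + Q.card := by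
  have hdisj : Disjoint G (Q.image (fun t => (k + 1, e, t))) := by
    rw [Finset.disjoint_left]
    intro p hp hp2
    obtain ⟨t, ht, rfl⟩ := Finset.mem_image.1 hp2
    have := (h.sub _ hp).2
    simp at this
  have hinj : Function.Injective (fun t : ℕ => (k + 1, e, t)) := by
    intro a b hab
    simpa using hab
  have hld : ∀ i, ld (G ∪ Q.image (fun t => (k + 1, e, t))) i
      = ld G i + if i ∈ Finset.Ioo (k + 1) e then Q.card else 0 := by
    intro i
    unfold ld
    rw [Finset.filter_union, Finset.card_union_of_disjoint
      (Finset.disjoint_filter_filter hdisj), Finset.filter_image]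
    congr 1
    rw [Finset.card_image_of_injective _ hinj]
    split_ifs with hi
    · rw [Finset.mem_Ioo] at hi
      simp [hi]
    · rw [Finset.mem_Ioo] at hi
      simp [hi]
  have hMcard : ∀ i, (if i ∈ Finset.Ioo (k + 1) e then M i ∪ Q else M i).card
      = (M i).card + if i ∈ Finset.Ioo (k + 1) e then Q.card else 0 := by
    intro i
    split_ifs with hi
    · rw [Finset.card_union_of_disjoint]
      rw [Finset.disjoint_left]
      intro t ht htQ
      have hpot := hQ t htQ
      rw [Finset.mem_Ioo] at hi
      rcases (h.mem i t).1 ht with ht | ⟨p, hp, hpt, h1, h2⟩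
      · exact hpot.2.2.2.2.2 i hi.1 hi.2 ht
      · have := Pot.unique (h.sub p hp).1 hpot hpt h1 h2 hi.1 hi.2
        subst this
        have := (h.sub _ hp).2
        simp at this
    · simp
  refine ⟨⟨?_, ?_, ?_, ?_, ?_⟩, ?_⟩
  · intro p hp
    rcases Finset.mem_union.1 hp with hp | hp
    · have := h.sub p hp
      refine ⟨this.1, ?_⟩
      omega
    · obtain ⟨t, ht, rfl⟩ := Finset.mem_image.1 hp
      exact ⟨hQ t ht, Or.inr ⟨rfl, by simp⟩⟩
  · intro i t
    have h0 := h.mem i t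
    have h1 : (t ∈ (if i ∈ Finset.Ioo (k + 1) e then M i ∪ Q else M i)) ↔
        t ∈ M i ∨ (t ∈ Q ∧ k + 1 < i ∧ i < e) := by
      split_ifs with hi
      · rw [Finset.mem_Ioo] at hi
        simp [hi]
      · rw [Finset.mem_Ioo] at hi
        simp [hi]
    rw [h1, h0]
    constructor
    · rintro ((h | ⟨p, hp, hh⟩) | ⟨h, hh⟩)
      · exact Or.inl h
      · exact Or.inr ⟨p, Finset.mem_union_left _ hp, hh⟩
      · exact Or.inr ⟨_, Finset.mem_union_right _ (Finset.mem_image_of_mem _ h), rfl, hh⟩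
    · rintro (h | ⟨p, hp, hh⟩)
      · exact Or.inl (Or.inl h)
      · rcases Finset.mem_union.1 hp with hp | hp
        · exact Or.inl (Or.inr ⟨p, hp, hh⟩)
        · obtain ⟨t', ht, rfl⟩ := Finset.mem_image.1 hp
          obtain ⟨rfl, hh⟩ := hh
          exact Or.inr ⟨ht, hh⟩
  · intro i hi
    have := hMcard i
    rw [this]
    have h1 := h.cap i hi
    have h2 := hroom i
    split_ifs with hi
    · exact h2 hi
    · omega
  · intro i
    have := hMcard i
    rw [this, hld, h.card i]
    omega
  · intro p hp hpr hpG
    rw [Finset.mem_union, not_or] at hpG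
    by_cases hold : p.2.1 < e ∨ (p.2.1 = e ∧ k + 1 < p.1)
    · obtain ⟨i, h1, h2, h3⟩ := h.rej p hp hold hpG.1
      refine ⟨i, h1, h2, h3.trans ?_⟩
      have := ld_mono (Finset.filter_subset_filter (fun q : ℕ × ℕ × ℕ => q.2.1 ≤ p.2.1)
        (Finset.subset_union_left (s₁ := G) (s₂ := Q.image (fun t => (k + 1, e, t))))) i
      omega
    · obtain ⟨s, e', t⟩ := p
      simp only at *
      have he : e' = e := by omega
      have hs : s = k + 1 := by omega
      subst he hs
      have htQ : t ∉ Q := fun ht => hpG.2 (Finset.mem_image_of_mem _ ht)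
      rcases hfull with hf | ⟨i, hi, hf⟩
      · exact absurd (hf t hp) htQ
      · have hi' := Finset.mem_Ioo.1 hi
        refine ⟨i, hi'.1, hi'.2, ?_⟩
        rw [Finset.filter_true_of_mem, hld, if_pos hi]
        · have := h.card i
          omega
        · intro q hq
          rcases Finset.mem_union.1 hq with hq | hq
          · have := (h.sub q hq).2
            omega
          · obtain ⟨t', _, rfl⟩ := Finset.mem_image.1 hq
            simp
  · rw [Finset.card_union_of_disjoint hdisj, Finset.card_image_of_injective _ hinj]

/-- Candidate tools for pipes from `s` to `e`. -/
def candOf (T : ℕ → Finset ℕ) (s e : ℕ) : Finset ℕ :=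
  (T s ∩ T e).filter fun t => ∀ i ∈ Finset.Ioo s e, t ∉ T i

lemma mpcaInner_succ (C : ℕ) (T : ℕ → Finset ℕ) (e k : ℕ) (M : ℕ → Finset ℕ) :
    mpcaInner C T e (k + 1) M =
    (let candidates := candOf T (k + 1) e
    let emptySlots :=
      if h : (Finset.Ioo (k + 1) e).Nonempty then
        (Finset.Ioo (k + 1) e).inf' h (fun i => C - (M i).card)
      else candidates.card
    let chosen := takeSome candidates (min candidates.card emptySlots)
    let M' := fun i => if i ∈ Finset.Ioo (k + 1) e then M i ∪ chosen else M i
    let r := mpcaInner C T e k M'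
    (r.1, r.2 + chosen.card)) := rfl

lemma inner_inv {n C : ℕ} {T : ℕ → Finset ℕ} {e : ℕ} (hen : e ≤ n) :
    ∀ (k : ℕ) (M : ℕ → Finset ℕ) (G : Finset (ℕ × ℕ × ℕ)), k < e → PInv n C T e k G M →
    ∃ G', PInv n C T e 0 G' (mpcaInner C T e k M).1 ∧
      G'.card = G.card + (mpcaInner C T e k M).2 := by
  intro k
  induction k with
  | zero => intro M G _ h; exact ⟨G, h, rfl⟩
  | succ k ih =>
    intro M G hk h
    rw [mpcaInner_succ]
    simp only
    generalize hcand : candOf T (k + 1) e = cand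
    set es := (if h : (Finset.Ioo (k + 1) e).Nonempty then
        (Finset.Ioo (k + 1) e).inf' h (fun i => C - (M i).card)
      else cand.card) with hes
    set Q := takeSome cand (min cand.card es) with hQdef
    have hmemc : ∀ t, t ∈ cand ↔ Pot n T (k + 1, e, t) := by
      intro t
      simp only [← hcand, candOf, Finset.mem_filter, Finset.mem_inter, Finset.mem_Ioo, Pot]
      constructor
      · rintro ⟨⟨a, b⟩, c⟩
        exact ⟨by omega, hk, hen, a, b, fun i h1 h2 => c i ⟨h1, h2⟩⟩
      · rintro ⟨_, _, _, a, b, c⟩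
        exact ⟨⟨a, b⟩, fun i hi => c i hi.1 hi.2⟩
    have hQc : Q ⊆ cand := takeSome_subset _ _
    have hQcard : Q.card = min cand.card es := by
      rw [hQdef, takeSome_card]; omega
    have hcap : ∀ i ∈ Finset.Ioo (k + 1) e, (M i).card ≤ C := by
      intro i hi
      rw [Finset.mem_Ioo] at hi
      exact h.cap i (Finset.mem_Icc.2 (by omega))
    obtain ⟨h1, h2⟩ := inv_step hen hk h Q (fun t ht => (hmemc t).1 (hQc ht)) (by
      intro i hi
      have hne : (Finset.Ioo (k + 1) e).Nonempty := ⟨i, hi⟩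
      rw [dif_pos hne] at hes
      have := Finset.inf'_le (fun i => C - (M i).card) hi
      have := hcap i hi
      omega) (by
      by_cases hc : cand.card ≤ es
      · left
        intro t ht
        have : Q = cand := Finset.eq_of_subset_of_card_le hQc (by omega)
        rw [this]
        exact (hmemc t).2 ht
      · right
        by_cases hne : (Finset.Ioo (k + 1) e).Nonempty
        · rw [dif_pos hne] at hes
          obtain ⟨i, hi, hi2⟩ := Finset.exists_mem_eq_inf' hne (fun i => C - (M i).card)
          refine ⟨i, hi, ?_⟩
          omega
        · rw [dif_neg hne] at hes
          omega)
    obtain ⟨G', h3, h4⟩ := ih _ _ (by omega) h1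
    refine ⟨G', h3, ?_⟩
    rw [h4, h2]
    omega

lemma outer_inv {n C : ℕ} {T : ℕ → Finset ℕ} (hT : ∀ i ∈ Finset.Icc 1 n, (T i).card ≤ C) :
    ∀ e, e ≤ n → ∃ G, PInv n C T (e + 1) e G (mpcaOuter C T e T).1 ∧
      G.card = (mpcaOuter C T e T).2 := by
  intro e
  induction e with
  | zero =>
    intro _
    refine ⟨∅, ⟨by simp, by simp [mpcaOuter], hT, by simp [mpcaOuter, ld], ?_⟩, rfl⟩
    intro p hp hpr
    have := hp.1
    have := hp.2.1
    omega
  | succ e ih =>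
    intro he
    obtain ⟨G, h1, h2⟩ := ih (by omega)
    obtain ⟨G', h3, h4⟩ := inner_inv he e _ G (by omega) h1
    refine ⟨G', ?_, ?_⟩
    · rw [mpcaOuter]
      refine ⟨?_, h3.mem, h3.cap, h3.card, ?_⟩
      · intro p hp
        have := h3.sub p hp
        exact ⟨this.1, by omega⟩
      · intro p hp hpr
        have := hp.1
        have := hp.2.1
        exact h3.rej p hp (by omega)
    · rw [mpcaOuter]
      simp only
      omega

/-- Previous state, with an empty magazine before the first job. -/
def pv (M : ℕ → Finset ℕ) (i : ℕ) : Finset ℕ := if i = 0 then ∅ else M i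

/-- Total number of loads, including those of the initial magazine. -/
def loads (n : ℕ) (M : ℕ → Finset ℕ) : ℕ := ∑ i ∈ Finset.range n, (M (i + 1) \ pv M i).card

lemma loads_congr {n : ℕ} {M M' : ℕ → Finset ℕ} (h : ∀ i, 1 ≤ i → i ≤ n → M i = M' i) :
    loads n M = loads n M' := by
  unfold loads
  apply Finset.sum_congr rfl
  intro i hi
  rw [Finset.mem_range] at hi
  rw [h (i + 1) (by omega) (by omega)]
  unfold pv
  split_ifs with h0
  · rfl
  · rw [h i (by omega) (by omega)]

lemma loads_eq {n C : ℕ} {T M : ℕ → Finset ℕ} (hn : 1 ≤ n) (hM : M ∈ MS n C T) :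
    loads n M = C + switches n C M := by
  obtain ⟨k, rfl⟩ : ∃ k, n = k + 1 := ⟨n - 1, by omega⟩
  unfold loads switches
  rw [Finset.sum_range_succ', add_comm]
  congr 1
  · simpa [pv] using (hM 1 (by simp)).2
  · rw [Nat.add_sub_cancel, Finset.range_eq_Ico,
      Finset.sum_Ico_add' (fun i => (M (i + 1) \ pv M i).card) 0 k 1]
    have : Finset.Ico (0 + 1) (k + 1) = Finset.Icc 1 k := by
      ext; simp
    rw [this]
    apply Finset.sum_congr rfl
    intro i hi
    rw [Finset.mem_Icc] at hi
    have h1 := (hM (i + 1) (by simp; omega)).2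
    rw [pv, if_neg (by omega), Finset.card_sdiff, h1]

lemma union_le_loads (B : ℕ → Finset ℕ) (n : ℕ) :
    ((Finset.Icc 1 n).biUnion B).card ≤ loads n B := by
  induction n with
  | zero => simp
  | succ n ih =>
    unfold loads at *
    rw [Finset.sum_range_succ]
    have h1 : (Finset.Icc 1 (n + 1)).biUnion B ⊆
        (Finset.Icc 1 n).biUnion B ∪ (B (n + 1) \ pv B n) := by
      intro t ht
      simp only [Finset.mem_biUnion, Finset.mem_Icc, Finset.mem_union, Finset.mem_sdiff, pv] at *
      obtain ⟨i, hi, ht⟩ := ht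
      by_cases h : i ≤ n
      · exact Or.inl ⟨i, ⟨hi.1, h⟩, ht⟩
      · obtain rfl : i = n + 1 := by omega
        by_cases h0 : n = 0
        · simp [h0] at *
          exact ht
        · by_cases hh : t ∈ B n
          · exact Or.inl ⟨n, by omega, hh⟩
          · right; simp [ht, h0, hh]
    have := Finset.card_le_card h1
    have := Finset.card_union_le ((Finset.Icc 1 n).biUnion B) (B (n + 1) \ pv B n)
    omega

lemma completion (C : ℕ) (B : ℕ → Finset ℕ) (n : ℕ)
    (hB : ∀ i ∈ Finset.Icc 1 n, (B i).card ≤ C)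
    (hU : C ≤ ((Finset.Icc 1 n).biUnion B).card) :
    ∃ M ∈ MS n C B, loads n M ≤ loads n B := by
  induction n with
  | zero => exact ⟨B, by intro i hi; simp at hi, le_rfl⟩
  | succ n ih =>
    have hBn := hB (n + 1) (by simp)
    by_cases hC : C ≤ ((Finset.Icc 1 n).biUnion B).card
    · obtain ⟨M, hM, hl⟩ := ih (fun i hi => hB i (by simp at *; omega)) hC
      have hc : C ≤ (B (n + 1) ∪ pv M n).card := by
        by_cases h0 : n = 0
        · subst h0
          simp at hC
          omega
        · rw [← (hM n (by simp; omega)).2, pv, if_neg h0]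
          exact Finset.card_le_card Finset.subset_union_right
      obtain ⟨V, hV1, hV2, hV3⟩ := Finset.exists_subsuperset_card_eq
        (Finset.subset_union_left (s₁ := B (n + 1)) (s₂ := pv M n)) hBn hc
      refine ⟨Function.update M (n + 1) V, ?_, ?_⟩
      · intro i hi
        by_cases h : i = n + 1
        · subst h; simp [hV1, hV3]
        · rw [Function.update_of_ne h]
          exact hM i (by simp at *; omega)
      · have h1 : loads n (Function.update M (n + 1) V) = loads n M :=
          loads_congr (fun i _ h => Function.update_of_ne (by omega) _ _)
        have h2 : pv (Function.update M (n + 1) V) n = pv M n := by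
          unfold pv
          rw [Function.update_of_ne (by omega)]
        have h3 : (V \ pv M n).card ≤ (B (n + 1) \ pv B n).card := by
          apply Finset.card_le_card
          intro t ht
          rw [Finset.mem_sdiff] at ht ⊢
          refine ⟨?_, fun hh => ht.2 ?_⟩
          · rcases Finset.mem_union.1 (hV2 ht.1) with h | h
            · exact h
            · exact absurd h ht.2
          · unfold pv at *
            split_ifs at * with h0
            · exact hh
            · exact (hM n (by simp; omega)).1 hh
        unfold loads at *
        rw [Finset.sum_range_succ, Finset.sum_range_succ, h1, h2, Function.update_self]
        omega
    · push Not at hC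
      set U := (Finset.Icc 1 n).biUnion B with hUdef
      have hUB : (Finset.Icc 1 (n + 1)).biUnion B = U ∪ B (n + 1) := by
        ext t
        simp only [hUdef, Finset.mem_biUnion, Finset.mem_Icc, Finset.mem_union]
        constructor
        · rintro ⟨i, hi, ht⟩
          by_cases h : i ≤ n
          · exact Or.inl ⟨i, ⟨hi.1, h⟩, ht⟩
          · obtain rfl : i = n + 1 := by omega
            exact Or.inr ht
        · rintro (⟨i, hi, ht⟩ | ht)
          · exact ⟨i, by omega, ht⟩
          · exact ⟨n + 1, by omega, ht⟩
      have hle := union_le_loads B (n + 1)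
      rw [hUB] at hU hle
      obtain ⟨W, hW1, hW2, hW3⟩ := Finset.exists_subsuperset_card_eq
        (Finset.subset_union_left (s₁ := U) (s₂ := B (n + 1))) hC.le hU
      obtain ⟨V, hV1, hV2, hV3⟩ := Finset.exists_subsuperset_card_eq
        (Finset.subset_union_right (s₁ := U) (s₂ := B (n + 1))) hBn hU
      refine ⟨fun i => if i ≤ n then W else V, ?_, ?_⟩
      · intro i hi
        rw [Finset.mem_Icc] at hi
        simp only
        split_ifs with h
        · refine ⟨fun t ht => hW1 ?_, hW3⟩
          exact Finset.mem_biUnion.2 ⟨i, Finset.mem_Icc.2 ⟨hi.1, h⟩, ht⟩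
        · obtain rfl : i = n + 1 := by omega
          exact ⟨hV1, hV3⟩
      · refine le_trans ?_ hle
        have h1 : (W ∪ V).card ≤ (U ∪ B (n + 1)).card :=
          Finset.card_le_card (Finset.union_subset hW2 hV2)
        have h2 : loads n (fun i => if i ≤ n then W else V) = loads n (fun _ => W) :=
          loads_congr (fun i _ h => by simp [h])
        unfold loads at h2 ⊢
        rw [Finset.sum_range_succ, h2]
        cases n with
        | zero =>
          have := Finset.card_le_card (Finset.subset_union_right (s₁ := W) (s₂ := V))
          simp only [pv, zero_add, Finset.range_zero, Finset.sum_empty, if_true,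
            Finset.sdiff_empty] at *
          simp
          omega
        | succ n =>
          rw [Finset.sum_range_succ']
          have := Finset.card_sdiff_add_card V W
          rw [Finset.union_comm] at this
          simp [pv]
          omega

/-- Tools kept in the magazine since their last use. -/
def kept (T M : ℕ → Finset ℕ) : ℕ → Finset ℕ
  | 0 => ∅
  | k + 1 => T (k + 1) ∪ (kept T M k ∩ M (k + 1))

lemma kept_spec (T M : ℕ → Finset ℕ) (k t : ℕ) (h : t ∈ kept T M k) :
    ∃ s, 1 ≤ s ∧ s ≤ k ∧ t ∈ T s ∧ ∀ i, s < i → i ≤ k → t ∉ T i ∧ t ∈ M i := by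
  induction k with
  | zero => simp [kept] at h
  | succ k ih =>
    by_cases hT : t ∈ T (k + 1)
    · exact ⟨k + 1, by omega, le_rfl, hT, fun i _ _ => by omega⟩
    · simp only [kept, Finset.mem_union, Finset.mem_inter, hT, false_or] at h
      obtain ⟨s, h1, h2, h3, h4⟩ := ih h.1
      refine ⟨s, h1, by omega, h3, fun i hi hi2 => ?_⟩
      by_cases h5 : i = k + 1
      · subst h5; exact ⟨hT, h.2⟩
      · exact h4 i hi (by omega)

lemma kept_bound {N C : ℕ} {T M : ℕ → Finset ℕ} (hM : M ∈ MS N C T) (n : ℕ) (hn : n ≤ N) :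
    ∑ i ∈ Finset.range n, (T (i + 1) \ kept T M i).card + (pv M n \ kept T M n).card
      ≤ loads n M := by
  induction n with
  | zero => simp [pv]
  | succ n ih =>
    have ih := ih (by omega)
    unfold loads at *
    rw [Finset.sum_range_succ, Finset.sum_range_succ]
    have hTM := (hM (n + 1) (by simp; omega)).1
    have h1 : (T (n + 1) \ kept T M n).card + (pv M (n + 1) \ kept T M (n + 1)).card ≤
        (M (n + 1) \ pv M n).card + (pv M n \ kept T M n).card := by
      rw [← Finset.card_union_of_disjoint]
      · refine le_trans (Finset.card_le_card ?_) (Finset.card_union_le _ _)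
        intro t ht
        have := @hTM t
        simp only [pv, kept, Finset.mem_union, Finset.mem_sdiff, Finset.mem_inter] at *
        simp only [Nat.add_eq_zero_iff, one_ne_zero, and_false, if_false] at ht
        tauto
      · rw [Finset.disjoint_left]
        intro t ht ht2
        simp only [kept, Finset.mem_union, Finset.mem_sdiff] at *
        tauto
    omega

lemma pipeSet_finite (n : ℕ) (T M : ℕ → Finset ℕ) : (pipeSet n T M).Finite := by
  apply Set.Finite.subset
    (Finset.finite_toSet (Finset.Icc 1 n ×ˢ Finset.Icc 1 n ×ˢ (Finset.Icc 1 n).biUnion T))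
  rintro ⟨s, e, t⟩ ⟨h1, h2, h3, h4, h5, h6⟩
  simp only at *
  simp only [Finset.coe_product, Set.mem_prod, Finset.mem_coe, Finset.mem_Icc, Finset.mem_biUnion]
  exact ⟨by omega, by omega, s, by omega, h4⟩

lemma pipes_ge {n : ℕ} {T M : ℕ → Finset ℕ} :
    ∑ i ∈ Finset.range n, (T (i + 1) ∩ kept T M i).card ≤ (pipeSet n T M).ncard := by
  rw [Set.ncard_eq_toFinset_card _ (pipeSet_finite n T M), ← Finset.card_sigma]
  refine le_trans (Finset.card_le_card ?_)
    (Finset.card_image_le (f := fun p : ℕ × ℕ × ℕ => (⟨p.2.1 - 1, p.2.2⟩ : Σ _ : ℕ, ℕ)))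
  rintro ⟨i, t⟩ h
  simp only [Finset.mem_sigma, Finset.mem_range, Finset.mem_inter] at h
  obtain ⟨s, h1, h2, h3, h4⟩ := kept_spec T M i t h.2.2
  refine Finset.mem_image.2 ⟨(s, i + 1, t), ?_, by simp⟩
  rw [Set.Finite.mem_toFinset]
  exact ⟨h1, by simp; omega, by simp; omega, h3, h.2.1, fun j a b => h4 j a (by simp at b; omega)⟩

lemma sum_shift (n : ℕ) (f : ℕ → ℕ) :
    ∑ i ∈ Finset.Icc 1 n, f i = ∑ i ∈ Finset.range n, f (i + 1) := by
  rw [Finset.range_eq_Ico, Finset.sum_Ico_add' f 0 n 1]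
  apply Finset.sum_congr _ (fun _ _ => rfl)
  ext; simp

lemma lower {n C : ℕ} {T M : ℕ → Finset ℕ} (hM : M ∈ MS n C T) :
    ∑ i ∈ Finset.Icc 1 n, (T i).card ≤ loads n M + (pipeSet n T M).ncard := by
  have h1 := kept_bound hM n le_rfl
  have h2 := pipes_ge (n := n) (T := T) (M := M)
  have h3 : ∑ i ∈ Finset.range n, (T (i + 1)).card =
      ∑ i ∈ Finset.range n, (T (i + 1) \ kept T M i).card +
      ∑ i ∈ Finset.range n, (T (i + 1) ∩ kept T M i).card := by
    rw [← Finset.sum_add_distrib]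
    exact Finset.sum_congr rfl fun i _ => (Finset.card_sdiff_add_card_inter _ _).symm
  rw [sum_shift]
  omega

lemma upper_pipes {n C : ℕ} {T M B : ℕ → Finset ℕ} {G : Finset (ℕ × ℕ × ℕ)}
    (hG : PInv n C T (n + 1) n G B) (hM : M ∈ MS n C T)
    (hT : ∀ i ∈ Finset.Icc 1 n, (T i).card ≤ C) :
    (pipeSet n T M).ncard ≤ G.card := by
  rw [Set.ncard_eq_toFinset_card _ (pipeSet_finite n T M)]
  set X := (pipeSet_finite n T M).toFinset with hX
  have hXm : ∀ p ∈ X, IsPipe n T M p.1 p.2.1 p.2.2 := by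
    intro p hp
    rw [hX, Set.Finite.mem_toFinset] at hp
    exact hp
  have hXp : ∀ p ∈ X, Pot n T p := by
    intro p hp
    obtain ⟨h1, h2, h3, h4, h5, h6⟩ := hXm p hp
    exact ⟨h1, h2, h3, h4, h5, fun i a b => (h6 i a b).1⟩
  refine greedy_opt (fun i => C - (T i).card) G ?_ _ X rfl ?_ ?_
  · intro i
    by_cases hi : i ∈ Finset.Icc 1 n
    · have := hG.cap i hi
      have := hG.card i
      omega
    · have : ld G i = 0 := by
        unfold ld
        rw [Finset.card_eq_zero, Finset.filter_eq_empty_iff]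
        intro p hp
        obtain ⟨h1, h2, h3, _⟩ := (hG.sub p hp).1
        rw [Finset.mem_Icc] at hi
        omega
      omega
  · intro i
    by_cases hi : i ∈ Finset.Icc 1 n
    · obtain ⟨h1, h2⟩ := hM i hi
      rw [← h2, ← Finset.card_sdiff_of_subset h1]
      unfold ld
      apply Finset.card_le_card_of_injOn (fun p => p.2.2)
      · intro p hp
        simp only [Finset.coe_filter, Set.mem_ofPred_eq] at hp
        have := (hXm p hp.1).2.2.2.2.2 i hp.2.1 hp.2.2
        simp [this]
      · intro p hp q hq hpq
        simp only [Finset.coe_filter, Set.mem_ofPred_eq] at hp hq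
        exact Pot.unique (hXp p hp.1) (hXp q hq.1) hpq hp.2.1 hp.2.2 hq.2.1 hq.2.2
    · have : ld X i = 0 := by
        unfold ld
        rw [Finset.card_eq_zero, Finset.filter_eq_empty_iff]
        intro p hp
        obtain ⟨h1, h2, h3, _⟩ := hXp p hp
        rw [Finset.mem_Icc] at hi
        omega
      omega
  · intro p hp hpG
    have hpot := hXp p hp
    obtain ⟨i, h1, h2, h3⟩ := hG.rej p hpot (by have := hpot.2.2.1; omega) hpG
    refine ⟨i, h1, h2, ?_⟩
    omega

lemma loads_B {n C : ℕ} {T B : ℕ → Finset ℕ} {G : Finset (ℕ × ℕ × ℕ)}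
    (hG : PInv n C T (n + 1) n G B) :
    loads n B + G.card ≤ ∑ i ∈ Finset.Icc 1 n, (T i).card := by
  rw [sum_shift]
  have h1 : G.card = ∑ i ∈ Finset.range n, (G.filter (fun p => p.2.1 - 1 = i)).card := by
    apply Finset.card_eq_sum_card_fiberwise
    intro p hp
    obtain ⟨h1, h2, h3, _⟩ := (hG.sub p hp).1
    simp
    omega
  rw [h1]
  unfold loads
  rw [← Finset.sum_add_distrib]
  apply Finset.sum_le_sum
  intro i hi
  have hTB : ∀ j t, t ∈ T j → t ∈ B j := fun j t ht => (hG.mem j t).2 (Or.inl ht)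
  have hinj : (G.filter (fun p => p.2.1 - 1 = i)).card =
      ((G.filter (fun p => p.2.1 - 1 = i)).image (fun p => p.2.2)).card := by
    rw [Finset.card_image_of_injOn]
    intro p hp q hq hpq
    simp only [Finset.coe_filter, Set.mem_ofPred_eq] at hp hq
    have a := (hG.sub p hp.1).1
    have b := (hG.sub q hq.1).1
    have a2 := a.2.1
    have b2 := b.2.1
    exact Pot.unique_end a b hpq (by omega)
  rw [hinj, ← Finset.card_union_of_disjoint]
  · apply Finset.card_le_card
    intro t ht
    rcases Finset.mem_union.1 ht with ht | ht
    · rw [Finset.mem_sdiff] at ht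
      rcases (hG.mem _ t).1 ht.1 with h | ⟨p, hp, rfl, h2, h3⟩
      · exact h
      · exfalso
        apply ht.2
        have hpot := (hG.sub p hp).1
        have := hpot.1
        rw [pv, if_neg (by omega)]
        by_cases h4 : p.1 = i
        · subst h4
          exact hTB _ _ hpot.2.2.2.1
        · exact (hG.mem _ _).2 (Or.inr ⟨p, hp, rfl, by omega, by omega⟩)
    · obtain ⟨p, hp, rfl⟩ := Finset.mem_image.1 ht
      rw [Finset.mem_filter] at hp
      have hpot := (hG.sub p hp.1).1
      have := hpot.2.1
      have e1 : i + 1 = p.2.1 := by omega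
      rw [e1]
      exact hpot.2.2.2.2.1
  · rw [Finset.disjoint_left]
    intro t ht ht2
    obtain ⟨p, hp, rfl⟩ := Finset.mem_image.1 ht2
    rw [Finset.mem_filter] at hp
    rw [Finset.mem_sdiff] at ht
    apply ht.2
    have hpot := (hG.sub p hp.1).1
    have := hpot.1
    have := hpot.2.1
    rw [pv, if_neg (by omega)]
    by_cases h4 : p.1 = i
    · subst h4
      exact hTB _ _ hpot.2.2.2.1
    · exact (hG.mem _ _).2 (Or.inr ⟨p, hp.1, rfl, by omega, by omega⟩)

/-- Theorem 2 and its corollary: the number of pipes produced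
by the MPCA greedy algorithm equals `max_{M ∈ M(S)} |T(M)|`; consequently
`min_{M ∈ M(S)} switches(M) = Σᵢ |Tᵢ| − C − MPCA(S)`. -/
theorem mpca_correct (n C m : ℕ) (T : ℕ → Finset ℕ)
    (hn : 1 ≤ n) (hCm : C < m)
    (hT : ∀ i ∈ Finset.Icc 1 n, (T i).card ≤ C)
    (hTsub : ∀ i ∈ Finset.Icc 1 n, T i ⊆ Finset.Icc 1 m)
    (hcover : (Finset.Icc 1 n).biUnion T = Finset.Icc 1 m) :
    MPCA n C T =
      sSup {k : ℕ | ∃ M ∈ MS n C T, (pipeSet n T M).ncard = k} ∧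
    ((sInf {k : ℕ | ∃ M ∈ MS n C T, switches n C M = k} : ℕ) : ℤ) =
      (∑ i ∈ Finset.Icc 1 n, ((T i).card : ℤ)) - C - MPCA n C T := by
  obtain ⟨G, hG, hGc⟩ := outer_inv hT n le_rfl
  change G.card = MPCA n C T at hGc
  set B := (mpcaOuter C T n T).1
  have hTB : ∀ i, T i ⊆ B i := fun i t ht => (hG.mem i t).2 (Or.inl ht)
  have hU : C ≤ ((Finset.Icc 1 n).biUnion B).card := by
    have h1 : (Finset.Icc 1 n).biUnion T ⊆ (Finset.Icc 1 n).biUnion B :=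
      Finset.biUnion_mono fun i _ => hTB i
    have := Finset.card_le_card h1
    rw [hcover, Nat.card_Icc] at this
    omega
  obtain ⟨M, hMB, hMl⟩ := completion C B n hG.cap hU
  have hM : M ∈ MS n C T := fun i hi => ⟨(hTB i).trans (hMB i hi).1, (hMB i hi).2⟩
  have hlb := loads_B hG
  have hup : ∀ M ∈ MS n C T, (pipeSet n T M).ncard ≤ MPCA n C T := by
    intro M hM
    rw [← hGc]
    exact upper_pipes hG hM hT
  have hlow : ∀ M ∈ MS n C T,
      ∑ i ∈ Finset.Icc 1 n, (T i).card ≤ C + switches n C M + (pipeSet n T M).ncard := by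
    intro M hM
    rw [← loads_eq hn hM]
    exact lower hM
  rw [loads_eq hn hM] at hMl
  have hM1 := hup M hM
  have hM2 := hlow M hM
  constructor
  · symm
    apply IsGreatest.csSup_eq
    refine ⟨⟨M, hM, by omega⟩, ?_⟩
    rintro k ⟨M', hM', rfl⟩
    exact hup M' hM'
  · have : sInf {k : ℕ | ∃ M ∈ MS n C T, switches n C M = k} = switches n C M := by
      apply IsLeast.csInf_eq
      refine ⟨⟨M, hM, rfl⟩, ?_⟩
      rintro k ⟨M', hM', rfl⟩
      have := hup M' hM'
      have := hlow M' hM'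
      omega
    rw [this]
    have : ∑ i ∈ Finset.Icc 1 n, ((T i).card : ℤ) =
      ((∑ i ∈ Finset.Icc 1 n, (T i).card : ℕ) : ℤ) := by push_cast; rfl
    rw [this]
    omega
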